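/- Let n ≥ 1, T > 0, M > 0. The heat kernel on ℝⁿ is K(x,t) = (4πt)^{−n/2} exp(−|x|²/(4t)) for t > 0. Let F : ℝⁿ × [0,T] → ℝ be continuous and bounded with |F(x,t)| ≤ M, and suppose m, S : [0,T] → ℝ are integrable with m(s) = inf_{x∈ℝⁿ} F(x,s) and S(s) = sup_{x∈ℝⁿ} F(x,s) for each s. Let G₀ : ℝⁿ → ℝ be continuous, nonnegative and bounded, and let G be the sum of the convolution series with terms G⁽⁰⁾(x,t) = (K(·,t)∗G₀)(x) and G⁽ᵏ⁺¹⁾(x,t) = ∫₀ᵗ (K(·,t−s)∗(F(·,s)·G⁽ᵏ⁾(·,s)))(x) ds. Then G(x,t) ≤ exp(∫₀ᵗ S(s) ds)·(K(·,t)∗G₀)(x) for all x ∈ ℝⁿ and t ∈ (0,T]. -/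

import Mathlib

open MeasureTheory Real

noncomputable section

abbrev E (n : ℕ) := EuclideanSpace ℝ (Fin n)

/-- The heat kernel on ℝⁿ. -/
def heatK (n : ℕ) (x : E n) (t : ℝ) : ℝ :=
  (4 * Real.pi * t) ^ (-(n : ℝ) / 2) * Real.exp (-‖x‖ ^ 2 / (4 * t))

/-- Spatial convolution. -/
def conv (n : ℕ) (f g : E n → ℝ) (x : E n) : ℝ := ∫ y, f (x - y) * g y

/-- The i-th spatial partial derivative. -/
def pd (n : ℕ) (f : E n → ℝ) (i : Fin n) (x : E n) : ℝ :=
  fderiv ℝ f x (EuclideanSpace.single i 1)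

/-- The spatial Laplacian. -/
def lap (n : ℕ) (f : E n → ℝ) (x : E n) : ℝ := ∑ i, pd n (pd n f i) i x

open Set

lemma heatK_nonneg (n : ℕ) (x : E n) {t : ℝ} (ht : 0 ≤ t) : 0 ≤ heatK n x t := by
  unfold heatK
  have : 0 ≤ 4 * Real.pi * t := by positivity
  exact mul_nonneg (Real.rpow_nonneg this _) (Real.exp_nonneg _)

lemma heatK_zero {n : ℕ} (hn : 1 ≤ n) (x : E n) : heatK n x 0 = 0 := by
  unfold heatK
  have h : (-(n : ℝ) / 2) ≠ 0 := by
    have : (0 : ℝ) < n := by exact_mod_cast hn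
    intro h
    linarith
  rw [mul_zero, Real.zero_rpow h, zero_mul]

lemma heatK_meas (n : ℕ) : Measurable (fun p : E n × ℝ => heatK n p.1 p.2) := by
  unfold heatK
  fun_prop

lemma heatK_integral (n : ℕ) {t : ℝ} (ht : 0 < t) : ∫ y : E n, heatK n y t = 1 := by
  unfold heatK
  rw [integral_const_mul]
  have h1 : ∀ y : E n, Real.exp (-‖y‖ ^ 2 / (4 * t)) = Real.exp (-(1 / (4 * t)) * ‖y‖ ^ 2) := by
    intro y; congr 1; ring
  simp_rw [h1]
  rw [GaussianFourier.integral_rexp_neg_mul_sq_norm (by positivity)]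
  have h2 : Real.pi / (1 / (4 * t)) = 4 * Real.pi * t := by field_simp
  rw [h2, finrank_euclideanSpace_fin, ← Real.rpow_add (by positivity)]
  have : -(n : ℝ) / 2 + n / 2 = 0 := by ring
  rw [this, Real.rpow_zero]

lemma heatK_integrable (n : ℕ) {t : ℝ} (ht : 0 < t) : Integrable (fun y : E n => heatK n y t) := by
  by_contra h
  have := heatK_integral n ht
  rw [integral_undef h] at this
  norm_num at this

lemma heatK_mul (n : ℕ) (x y z : E n) {a b : ℝ} (ha : 0 < a) (hb : 0 < b) :
    heatK n (x - z) a * heatK n (z - y) b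
      = heatK n (x - y) (a + b) *
        heatK n (z - ((b / (a + b)) • x + (a / (a + b)) • y)) (a * b / (a + b)) := by
  unfold heatK
  have hc : (4 * Real.pi * a) ^ (-(n : ℝ) / 2) * (4 * Real.pi * b) ^ (-(n : ℝ) / 2)
      = (4 * Real.pi * (a + b)) ^ (-(n : ℝ) / 2)
        * (4 * Real.pi * (a * b / (a + b))) ^ (-(n : ℝ) / 2) := by
    rw [← Real.mul_rpow (by positivity) (by positivity),
      ← Real.mul_rpow (by positivity) (by positivity)]
    congr 1
    field_simp
  have he : -‖x - z‖ ^ 2 / (4 * a) + -‖z - y‖ ^ 2 / (4 * b)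
      = -‖x - y‖ ^ 2 / (4 * (a + b)) +
        -‖z - ((b / (a + b)) • x + (a / (a + b)) • y)‖ ^ 2 / (4 * (a * b / (a + b))) := by
    simp only [EuclideanSpace.norm_sq_eq, Finset.sum_div, ← Finset.sum_neg_distrib,
      ← Finset.sum_add_distrib]
    refine Finset.sum_congr rfl fun i _ => ?_
    simp only [PiLp.sub_apply, PiLp.add_apply, PiLp.smul_apply, smul_eq_mul, Real.norm_eq_abs,
      sq_abs]
    field_simp
    ring
  calc _ = ((4 * Real.pi * a) ^ (-(n : ℝ) / 2) * (4 * Real.pi * b) ^ (-(n : ℝ) / 2)) *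
        (Real.exp (-‖x - z‖ ^ 2 / (4 * a)) * Real.exp (-‖z - y‖ ^ 2 / (4 * b))) := by ring
    _ = _ := by
      rw [hc, ← Real.exp_add, he, Real.exp_add]; ring

lemma heatK_semi (n : ℕ) (x y : E n) {a b : ℝ} (ha : 0 < a) (hb : 0 < b) :
    ∫ z, heatK n (x - z) a * heatK n (z - y) b = heatK n (x - y) (a + b) := by
  simp_rw [heatK_mul n x y _ ha hb]
  rw [integral_const_mul,
    integral_sub_right_eq_self (fun z : E n => heatK n z (a * b / (a + b))),
    heatK_integral n (by positivity), mul_one]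

/-- heat semigroup -/
def PP (n : ℕ) (t : ℝ) (f : E n → ℝ) (x : E n) : ℝ := ∫ y, heatK n (x - y) t * f y

lemma PP_int {n : ℕ} {t : ℝ} (ht : 0 < t) {f : E n → ℝ} (hf : Measurable f) {C : ℝ}
    (hC : ∀ y, |f y| ≤ C) (x : E n) : Integrable (fun y => heatK n (x - y) t * f y) := by
  have h := (heatK_integrable n ht).comp_sub_left x
  exact h.mul_bdd (c := C) hf.aestronglyMeasurable (Filter.Eventually.of_forall hC)

lemma PP_zero {n : ℕ} (hn : 1 ≤ n) (f : E n → ℝ) (x : E n) : PP n 0 f x = 0 := by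
  simp [PP, heatK_zero hn]

lemma PP_const {n : ℕ} {t : ℝ} (ht : 0 < t) (c : ℝ) (x : E n) : PP n t (fun _ => c) x = c := by
  unfold PP
  rw [integral_mul_const, integral_sub_left_eq_self (fun y => heatK n y t), heatK_integral n ht,
    one_mul]

lemma PP_mono {n : ℕ} (hn : 1 ≤ n) {t : ℝ} (ht : 0 ≤ t) {f g : E n → ℝ} (hf : Measurable f)
    (hg : Measurable g) {C D : ℝ} (hC : ∀ y, |f y| ≤ C) (hD : ∀ y, |g y| ≤ D)
    (hfg : ∀ y, f y ≤ g y) (x : E n) : PP n t f x ≤ PP n t g x := by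
  rcases ht.eq_or_lt with rfl | ht'
  · rw [PP_zero hn, PP_zero hn]
  · exact integral_mono (PP_int ht' hf hC x) (PP_int ht' hg hD x)
      fun y => mul_le_mul_of_nonneg_left (hfg y) (heatK_nonneg n _ ht)

lemma PP_nonneg {n : ℕ} {t : ℝ} (ht : 0 ≤ t) {f : E n → ℝ} (hf : ∀ y, 0 ≤ f y) (x : E n) :
    0 ≤ PP n t f x :=
  integral_nonneg fun y => mul_nonneg (heatK_nonneg n _ ht) (hf y)

lemma PP_le {n : ℕ} (hn : 1 ≤ n) {t : ℝ} (ht : 0 ≤ t) {f : E n → ℝ} (hf : Measurable f)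
    {C D : ℝ} (hC : ∀ y, |f y| ≤ C) (hD : ∀ y, f y ≤ D) (hD0 : 0 ≤ D) (x : E n) :
    PP n t f x ≤ D := by
  rcases ht.eq_or_lt with rfl | ht'
  · rw [PP_zero hn]; exact hD0
  · rw [← PP_const ht' D x]
    exact PP_mono hn ht hf measurable_const hC (fun _ => le_refl |D|) hD x

lemma PP_abs {n : ℕ} (hn : 1 ≤ n) {t : ℝ} (ht : 0 ≤ t) {f : E n → ℝ} (hf : Measurable f)
    {C : ℝ} (hC : ∀ y, |f y| ≤ C) (x : E n) : |PP n t f x| ≤ C := by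
  have hC0 : 0 ≤ C := (abs_nonneg _).trans (hC 0)
  have h1 := PP_le hn ht hf hC (fun y => (abs_le.1 (hC y)).2) hC0 x
  have h2 := PP_le hn ht (f := fun y => - f y) hf.neg (C := C) (by simpa using hC)
    (fun y => by linarith [(abs_le.1 (hC y)).1]) hC0 x
  have h3 : PP n t (fun y => - f y) x = - PP n t f x := by
    simp [PP, integral_neg]
  rw [h3] at h2
  exact abs_le.2 ⟨by linarith, h1⟩

lemma PP_meas {n : ℕ} {f : E n → ℝ → ℝ} (hf : Measurable fun q : E n × ℝ => f q.1 q.2) :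
    Measurable fun q : (E n × ℝ) × ℝ => PP n (q.1.2 - q.2) (fun y => f y q.2) q.1.1 := by
  unfold PP
  have h : Measurable (fun p : ((E n × ℝ) × ℝ) × E n =>
      heatK n (p.1.1.1 - p.2) (p.1.1.2 - p.1.2) * f p.2 p.1.2) := by
    have h1 : Measurable (fun p : ((E n × ℝ) × ℝ) × E n =>
      heatK n (p.1.1.1 - p.2) (p.1.1.2 - p.1.2)) :=
      (heatK_meas n).comp (g := fun q : E n × ℝ => heatK n q.1 q.2)
        (f := fun p : ((E n × ℝ) × ℝ) × E n => (p.1.1.1 - p.2, p.1.1.2 - p.1.2)) (by fun_prop)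
    have h2 : Measurable (fun p : ((E n × ℝ) × ℝ) × E n => f p.2 p.1.2) :=
      hf.comp (f := fun p : ((E n × ℝ) × ℝ) × E n => (p.2, p.1.2)) (by fun_prop)
    exact h1.mul h2
  exact (h.stronglyMeasurable.integral_prod_right (ν := volume)).measurable

lemma PP_meas' {n : ℕ} {f : E n → ℝ} (hf : Measurable f) :
    Measurable fun q : E n × ℝ => PP n q.2 f q.1 := by
  have := (PP_meas (f := fun y _ => f y) (hf.comp measurable_fst)).comp
    (f := fun q : E n × ℝ => (q, (0:ℝ))) (by fun_prop)
  simpa [Function.comp_def] using this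

lemma PP_semi {n : ℕ} {a b : ℝ} (ha : 0 < a) (hb : 0 < b) {f : E n → ℝ} (hf : Measurable f)
    {C : ℝ} (hC : ∀ y, |f y| ≤ C) (x : E n) :
    PP n a (PP n b f) x = PP n (a + b) f x := by
  have hC0 : 0 ≤ C := (abs_nonneg _).trans (hC 0)
  unfold PP
  simp_rw [← integral_const_mul]
  rw [integral_integral_swap]
  · refine integral_congr_ae (Filter.Eventually.of_forall fun y => ?_)
    simp only [← mul_assoc]
    rw [integral_mul_const, heatK_semi n x y ha hb]
  · have hmeas : Measurable (Function.uncurry fun z y : E n =>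
        heatK n (x - z) a * (heatK n (z - y) b * f y)) := by
      have h1 : Measurable (fun p : E n × E n => heatK n (x - p.1) a) :=
        (heatK_meas n).comp (g := fun q : E n × ℝ => heatK n q.1 q.2)
          (f := fun p : E n × E n => (x - p.1, a)) (by fun_prop)
      have h2 : Measurable (fun p : E n × E n => heatK n (p.1 - p.2) b) :=
        (heatK_meas n).comp (g := fun q : E n × ℝ => heatK n q.1 q.2)
          (f := fun p : E n × E n => (p.1 - p.2, b)) (by fun_prop)
      exact h1.mul (h2.mul (hf.comp measurable_snd))
    rw [integrable_prod_iff hmeas.aestronglyMeasurable]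
    constructor
    · refine Filter.Eventually.of_forall fun z => ?_
      simpa only [Function.uncurry_apply_pair] using
        (PP_int hb hf hC z).const_mul (heatK n (x - z) a)
    · have h3 : ∀ z : E n, ∫ y, ‖heatK n (x - z) a * (heatK n (z - y) b * f y)‖
          = heatK n (x - z) a * PP n b (fun y => |f y|) z := by
        intro z
        unfold PP
        rw [← integral_const_mul]
        refine integral_congr_ae (Filter.Eventually.of_forall fun y => ?_)
        simp only [Real.norm_eq_abs, abs_mul, abs_of_nonneg (heatK_nonneg n _ ha.le),
          abs_of_nonneg (heatK_nonneg n _ hb.le)]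
      simp only [Function.uncurry_apply_pair, h3]
      have hm : Measurable (fun z => PP n b (fun y => |f y|) z) :=
        (PP_meas' (n := n) (f := fun y => |f y|) (by fun_prop)).comp
          (f := fun z : E n => (z, b)) (by fun_prop)
      have h4 := (heatK_integrable n ha).comp_sub_left x
      refine h4.mul_bdd (c := C) hm.aestronglyMeasurable (Filter.Eventually.of_forall fun z => ?_)
      rw [Real.norm_eq_abs, abs_of_nonneg (PP_nonneg hb.le (fun y => abs_nonneg _) z),
        ← PP_const hb C z]
      exact integral_mono (PP_int hb (by fun_prop) (C := C) (by simpa using hC) z)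
        (PP_int hb measurable_const (C := |C|) (by simp) z)
        fun y => mul_le_mul_of_nonneg_left (hC y) (heatK_nonneg n _ hb.le)

/-- Duhamel operator -/
def AA (n : ℕ) (f : E n → ℝ → ℝ) (x : E n) (t : ℝ) : ℝ :=
  ∫ s in (0:ℝ)..t, PP n (t - s) (fun y => f y s) x

lemma meas_slice {n : ℕ} {f : E n → ℝ → ℝ} (hf : Measurable fun q : E n × ℝ => f q.1 q.2)
    (s : ℝ) : Measurable fun y => f y s :=
  hf.comp (f := fun y : E n => (y, s)) (by fun_prop)

lemma AA_meas {n : ℕ} {f : E n → ℝ → ℝ} (hf : Measurable fun q : E n × ℝ => f q.1 q.2) :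
    Measurable fun q : E n × ℝ => AA n f q.1 q.2 := by
  have h := PP_meas hf
  have hA : MeasurableSet {p : (E n × ℝ) × ℝ | p.2 ∈ Ioc 0 p.1.2} := by
    have e1 : MeasurableSet {p : (E n × ℝ) × ℝ | (0:ℝ) < p.2} :=
      measurableSet_lt (by fun_prop) (by fun_prop)
    have e2 : MeasurableSet {p : (E n × ℝ) × ℝ | p.2 ≤ p.1.2} :=
      measurableSet_le (by fun_prop) (by fun_prop)
    exact e1.inter e2
  have hB : MeasurableSet {p : (E n × ℝ) × ℝ | p.2 ∈ Ioc p.1.2 0} := by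
    have e1 : MeasurableSet {p : (E n × ℝ) × ℝ | p.1.2 < p.2} :=
      measurableSet_lt (by fun_prop) (by fun_prop)
    have e2 : MeasurableSet {p : (E n × ℝ) × ℝ | p.2 ≤ (0:ℝ)} :=
      measurableSet_le (by fun_prop) (by fun_prop)
    exact e1.inter e2
  have h1 := ((h.indicator hA).stronglyMeasurable.integral_prod_right' (ν := volume)).measurable
  have h2 := ((h.indicator hB).stronglyMeasurable.integral_prod_right' (ν := volume)).measurable
  convert h1.sub h2 using 1
  ext q
  unfold AA intervalIntegral
  rw [Pi.sub_apply, ← integral_indicator measurableSet_Ioc, ← integral_indicator measurableSet_Ioc]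
  rfl

lemma PP_ii {n : ℕ} (hn : 1 ≤ n) {f : E n → ℝ → ℝ}
    (hf : Measurable fun q : E n × ℝ => f q.1 q.2) {C : ℝ} (hC : ∀ y s, |f y s| ≤ C)
    (x : E n) {t t' : ℝ} (h0 : 0 ≤ t') (ht : t' ≤ t) :
    IntervalIntegrable (fun s => PP n (t - s) (fun y => f y s) x) volume 0 t' := by
  rw [intervalIntegrable_iff_integrableOn_Ioc_of_le h0]
  have hm : Measurable (fun s => PP n (t - s) (fun y => f y s) x) :=
    (PP_meas hf).comp (f := fun s : ℝ => ((x, t), s)) (by fun_prop)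
  refine Measure.integrableOn_of_bounded (M := C) (by simp) hm.aestronglyMeasurable ?_
  refine ae_restrict_of_forall_mem measurableSet_Ioc fun s hs => ?_
  exact PP_abs hn (by linarith [hs.2]) (meas_slice hf s) (fun y => hC y s) x

lemma PP_AA {n : ℕ} (hn : 1 ≤ n) {f : E n → ℝ → ℝ}
    (hf : Measurable fun q : E n × ℝ => f q.1 q.2) {C : ℝ} (hC : ∀ y s, |f y s| ≤ C)
    (x : E n) {a s : ℝ} (ha : 0 < a) (hs : 0 < s) :
    PP n a (fun y => AA n f y s) x = ∫ r in (0:ℝ)..s, PP n (a + s - r) (fun y => f y r) x := by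
  have h1 : PP n a (fun y => AA n f y s) x = ∫ y, ∫ r in (0:ℝ)..s,
      heatK n (x - y) a * PP n (s - r) (fun y => f y r) y := by
    unfold AA
    simp_rw [intervalIntegral.integral_const_mul]
    rfl
  rw [h1, ← intervalIntegral_integral_swap
    (f := fun r y => heatK n (x - y) a * PP n (s - r) (fun y => f y r) y)]
  · refine intervalIntegral.integral_congr_ae ?_
    have hne : ∀ᵐ r : ℝ, r ≠ s := by simp [ae_iff]
    filter_upwards [hne] with r hr hr'
    rw [uIoc_of_le hs.le] at hr'
    have hlt : r < s := lt_of_le_of_ne hr'.2 hr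
    have := PP_semi ha (sub_pos.2 hlt) (meas_slice hf r) (fun y => hC y r) x
    rw [add_sub_assoc, ← this]
    rfl
  · rw [uIoc_of_le hs.le]
    have hk := (heatK_integrable n ha).comp_sub_left x
    have hd : Integrable (fun p : ℝ × E n => C * heatK n (x - p.2) a)
        ((volume.restrict (Ioc 0 s)).prod volume) :=
      Integrable.mul_prod (f := fun _ : ℝ => C) (g := fun y => heatK n (x - y) a)
        (integrable_const C) hk
    refine hd.mono' ?_ ?_
    · refine Measurable.aestronglyMeasurable ?_
      have m1 : Measurable (fun p : ℝ × E n => heatK n (x - p.2) a) :=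
        (heatK_meas n).comp (g := fun q : E n × ℝ => heatK n q.1 q.2)
          (f := fun p : ℝ × E n => (x - p.2, a)) (by fun_prop)
      have m2 : Measurable (fun p : ℝ × E n => PP n (s - p.1) (fun y => f y p.1) p.2) :=
        (PP_meas hf).comp (f := fun p : ℝ × E n => ((p.2, s), p.1)) (by fun_prop)
      exact m1.mul m2
    · have he : (volume.restrict (Ioc 0 s)).prod (volume : Measure (E n))
          = ((volume : Measure ℝ).prod (volume : Measure (E n))).restrict (Ioc 0 s ×ˢ univ) := by
        rw [← Measure.prod_restrict, Measure.restrict_univ]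
      rw [he]
      refine ae_restrict_of_forall_mem (measurableSet_Ioc.prod MeasurableSet.univ) fun p hp => ?_
      have hp1 := hp.1
      simp only [Function.uncurry, Real.norm_eq_abs, abs_mul,
        abs_of_nonneg (heatK_nonneg n _ ha.le)]
      rw [mul_comm]
      refine mul_le_mul_of_nonneg_right ?_ (heatK_nonneg n _ ha.le)
      exact PP_abs hn (by linarith [hp1.2]) (meas_slice hf p.1) (fun y => hC y p.1) p.2

lemma ibp_exp {g : ℝ → ℝ} {t : ℝ} (hg : IntervalIntegrable g volume 0 t) (M c : ℝ) :
    ∫ s in (0:ℝ)..t, (M * Real.exp (M * s) * (c + ∫ r in (0:ℝ)..s, g r) + Real.exp (M * s) * g s)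
      = Real.exp (M * t) * (c + ∫ r in (0:ℝ)..t, g r) - c := by
  have h1 : AbsolutelyContinuousOnInterval (fun s => Real.exp (M * s)) 0 t := by
    apply ContDiffOn.absolutelyContinuousOnInterval
    fun_prop
  have h2 : AbsolutelyContinuousOnInterval (fun s => c + ∫ r in (0:ℝ)..s, g r) 0 t := by
    have hc : AbsolutelyContinuousOnInterval (fun _ : ℝ => c) 0 t := by
      apply ContDiffOn.absolutelyContinuousOnInterval
      fun_prop
    exact hc.add (hg.absolutelyContinuousOnInterval_intervalIntegral (c := 0) (by simp))
  have h3 := AbsolutelyContinuousOnInterval.integral_deriv_mul_eq_sub h1 h2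
  simp only [mul_zero, Real.exp_zero, one_mul, intervalIntegral.integral_same, add_zero] at h3
  rw [← h3]
  refine intervalIntegral.integral_congr_ae ?_
  filter_upwards [hg.ae_hasDerivAt_integral] with s hs hs'
  have h4 := (hs (uIoc_subset_uIcc hs') 0 (by simp)).const_add c
  have h5 : HasDerivAt (fun s => Real.exp (M * s)) (Real.exp (M * s) * (M * 1)) s :=
    ((hasDerivAt_id s).const_mul M).exp
  rw [h4.deriv, h5.deriv]
  ring

lemma exp_ftc {S : ℝ → ℝ} {K : ℝ} (hS : ∀ a b, IntervalIntegrable S volume a b)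
    (hK : ∀ s, |S s| ≤ K) (t : ℝ) :
    ∫ s in (0:ℝ)..t, S s * Real.exp (∫ r in (0:ℝ)..s, S r)
      = Real.exp (∫ r in (0:ℝ)..t, S r) - 1 := by
  have hK0 : 0 ≤ K := (abs_nonneg _).trans (hK 0)
  set Φ : ℝ → ℝ := fun s => ∫ r in (0:ℝ)..s, S r with hΦ
  have hL : LipschitzWith ⟨K, hK0⟩ Φ := by
    refine LipschitzWith.of_dist_le_mul fun a b => ?_
    rw [Real.dist_eq, Real.dist_eq, hΦ]
    simp only
    rw [intervalIntegral.integral_interval_sub_left (hS _ _) (hS _ _)]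
    exact intervalIntegral.norm_integral_le_of_norm_le_const (f := S) (C := K) fun s _ => hK s
  obtain ⟨R, hR⟩ := (isCompact_uIcc (a := (0:ℝ)) (b := t)).exists_bound_of_continuousOn
    hL.continuous.continuousOn
  have hE : ContDiffOn ℝ 1 Real.exp (Icc (-R) R) := Real.contDiff_exp.contDiffOn
  obtain ⟨L, hL'⟩ := hE.exists_lipschitzOnWith (by decide) (convex_Icc _ _) isCompact_Icc
  have hcomp : LipschitzOnWith (L * ⟨K, hK0⟩) (Real.exp ∘ Φ) (uIcc 0 t) :=
    hL'.comp hL.lipschitzOnWith fun s hs => abs_le.1 (hR s hs)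
  have h := hcomp.absolutelyContinuousOnInterval.integral_deriv_eq_sub
  have h0 : Φ 0 = 0 := by simp [hΦ]
  simp only [Function.comp_apply, h0, Real.exp_zero] at h
  rw [← h]
  refine intervalIntegral.integral_congr_ae ?_
  filter_upwards [(hS 0 t).ae_hasDerivAt_integral] with s hs hs'
  have h4 := (hs (uIoc_subset_uIcc hs') 0 (by simp)).exp
  have h5 : deriv (Real.exp ∘ Φ) s = Real.exp (Φ s) * S s := h4.deriv
  rw [h5, mul_comm]

lemma shift_eq {n : ℕ} (hn : 1 ≤ n) {T M C C0 : ℝ} {F u : E n → ℝ → ℝ} {G0 : E n → ℝ}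
    (hFm : Measurable fun q : E n × ℝ => F q.1 q.2) (hF : ∀ y s, |F y s| ≤ M)
    (hum : Measurable fun q : E n × ℝ => u q.1 q.2) (hu : ∀ y s, |u y s| ≤ C)
    (hGm : Measurable G0) (hG : ∀ y, |G0 y| ≤ C0)
    (heq : ∀ x, ∀ t ∈ Ioc 0 T, u x t = PP n t G0 x + AA n (fun y s => F y s * u y s) x t)
    (x : E n) {t : ℝ} (ht : t ∈ Ioc 0 T) :
    Real.exp (M * t) * u x t = PP n t G0 x
      + AA n (fun y s => (F y s + M) * (Real.exp (M * s) * u y s)) x t := by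
  have hfm : Measurable fun q : E n × ℝ => F q.1 q.2 * u q.1 q.2 := hFm.mul hum
  have hf : ∀ y s, |F y s * u y s| ≤ M * C := fun y s => by
    rw [abs_mul]
    exact mul_le_mul (hF y s) (hu y s) (abs_nonneg _) ((abs_nonneg _).trans (hF y s))
  have hg := PP_ii hn (f := fun y s => F y s * u y s) hfm hf x ht.1.le le_rfl
  have key := ibp_exp hg M (PP n t G0 x)
  have h1 : AA n (fun y s => (F y s + M) * (Real.exp (M * s) * u y s)) x t
      = Real.exp (M * t) * (PP n t G0 x + AA n (fun y s => F y s * u y s) x t) - PP n t G0 x := by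
    rw [AA, AA, ← key]
    refine intervalIntegral.integral_congr_ae ?_
    have hne : ∀ᵐ r : ℝ, r ≠ t := by simp [ae_iff]
    filter_upwards [hne] with s hs1 hs2
    rw [uIoc_of_le ht.1.le] at hs2
    have hlt : s < t := lt_of_le_of_ne hs2.2 hs1
    have hpos : 0 < t - s := sub_pos.2 hlt
    have hsT : s ∈ Ioc 0 T := ⟨hs2.1, hs2.2.trans ht.2⟩
    have i1 := PP_int hpos (meas_slice (f := fun y s => F y s * u y s) hfm s)
      (fun y => hf y s) x
    have i2 := PP_int hpos (meas_slice hum s) (fun y => hu y s) x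
    have e1 : PP n (t - s) (fun y => (F y s + M) * (Real.exp (M * s) * u y s)) x
        = Real.exp (M * s) * PP n (t - s) (fun y => F y s * u y s) x
          + M * Real.exp (M * s) * PP n (t - s) (fun y => u y s) x := by
      unfold PP
      rw [← integral_const_mul, ← integral_const_mul, ← integral_add (i1.const_mul _)
        (i2.const_mul _)]
      refine integral_congr_ae (Filter.Eventually.of_forall fun y => ?_)
      simp only
      ring
    have e2 : PP n (t - s) (fun y => u y s) x = PP n t G0 x
        + ∫ r in (0:ℝ)..s, PP n (t - r) (fun y => F y r * u y r) x := by
      have e3 : (fun y => u y s)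
          = fun y => PP n s G0 y + AA n (fun y s => F y s * u y s) y s := by
        funext y; exact heq y s hsT
      have m1 : Measurable (fun y => PP n s G0 y) :=
        (PP_meas' hGm).comp (f := fun y : E n => (y, s)) (by fun_prop)
      have m2 : Measurable (fun y => AA n (fun y s => F y s * u y s) y s) :=
        meas_slice (AA_meas (f := fun y s => F y s * u y s) hfm) s
      have b1 : ∀ y, |PP n s G0 y| ≤ C0 := fun y => PP_abs hn hs2.1.le hGm hG y
      have b2 : ∀ y, |AA n (fun y s => F y s * u y s) y s| ≤ C + C0 := fun y => by
        have : AA n (fun y s => F y s * u y s) y s = u y s - PP n s G0 y := by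
          rw [heq y s hsT]; ring
        rw [this]
        exact (abs_sub _ _).trans (add_le_add (hu y s) (b1 y))
      have e4 := PP_AA hn (f := fun y s => F y s * u y s) hfm hf x hpos hs2.1
      have e5 := PP_semi hpos hs2.1 hGm hG x
      rw [sub_add_cancel] at e4 e5
      rw [e3, ← e4, ← e5]
      refine Eq.trans ?_ (integral_add (PP_int hpos m1 b1 x) (PP_int hpos m2 b2 x))
      refine integral_congr_ae (Filter.Eventually.of_forall fun y => ?_)
      simp only [PP]
      ring
    rw [e1, e2]
    ring
  rw [h1, ← heq x t ht]
  ring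

lemma gron {n : ℕ} (hn : 1 ≤ n) {T L C : ℝ} {F D : E n → ℝ → ℝ}
    (hFm : Measurable fun q : E n × ℝ => F q.1 q.2) (hF0 : ∀ y s, 0 ≤ F y s)
    (hF : ∀ y s, F y s ≤ L)
    (hDm : Measurable fun q : E n × ℝ => D q.1 q.2) (hD : ∀ y s, |D y s| ≤ C)
    (hle : ∀ x, ∀ t ∈ Ioc 0 T, D x t ≤ AA n (fun y s => F y s * D y s) x t)
    (x : E n) {t : ℝ} (ht : t ∈ Ioc 0 T) : D x t ≤ 0 := by
  have hC0 : 0 ≤ C := (abs_nonneg _).trans (hD 0 0)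
  have hL0 : 0 ≤ L := (hF0 0 0).trans (hF 0 0)
  have hfm : Measurable fun q : E n × ℝ => F q.1 q.2 * D q.1 q.2 := hFm.mul hDm
  have hf : ∀ y s, |F y s * D y s| ≤ L * C := fun y s => by
    rw [abs_mul, abs_of_nonneg (hF0 y s)]
    exact mul_le_mul (hF y s) (hD y s) (abs_nonneg _) hL0
  have main : ∀ k : ℕ, ∀ x, ∀ t ∈ Ioc 0 T, D x t ≤ C * ((L * t) ^ k / k.factorial) := by
    intro k
    induction k with
    | zero => intro x t _; simpa using (abs_le.1 (hD x t)).2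
    | succ k ih =>
      intro x t ht
      refine (hle x t ht).trans ?_
      have hinteg : ∫ s in (0:ℝ)..t, L * (C * ((L * s) ^ k / k.factorial))
          = C * ((L * t) ^ (k + 1) / (k + 1).factorial) := by
        have : ∀ s : ℝ, L * (C * ((L * s) ^ k / k.factorial))
            = (L * C * L ^ k / k.factorial) * s ^ k := fun s => by rw [mul_pow]; ring
        simp_rw [this]
        rw [intervalIntegral.integral_const_mul, integral_pow, Nat.factorial_succ]
        push_cast
        have : (k.factorial : ℝ) ≠ 0 := by positivity
        field_simp
        ring
      rw [← hinteg]
      unfold AA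
      refine intervalIntegral.integral_mono_on_of_le_Ioo ht.1.le
        (PP_ii hn (f := fun y s => F y s * D y s) hfm hf x ht.1.le le_rfl)
        (Continuous.intervalIntegrable (by fun_prop) _ _) fun s hs => ?_
      have hsT : s ∈ Ioc 0 T := ⟨hs.1, hs.2.le.trans ht.2⟩
      have hs0 := hs.1
      have hnn : 0 ≤ C * ((L * s) ^ k / k.factorial) := by positivity
      refine PP_le hn (by linarith [hs.2])
        (meas_slice (f := fun y s => F y s * D y s) hfm s) (fun y => hf y s) (fun y => ?_)
        (mul_nonneg hL0 hnn) x
      calc F y s * D y s ≤ F y s * (C * ((L * s) ^ k / k.factorial)) :=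
            mul_le_mul_of_nonneg_left (ih y s hsT) (hF0 y s)
        _ ≤ _ := mul_le_mul_of_nonneg_right (hF y s) hnn
  have hlim := (FloorSemiring.tendsto_pow_div_factorial_atTop (L * t)).const_mul C
  rw [mul_zero] at hlim
  exact ge_of_tendsto' hlim fun k => main k x t ht

lemma AA_sub {n : ℕ} (hn : 1 ≤ n) {f g : E n → ℝ → ℝ} {C D : ℝ}
    (hf : Measurable fun q : E n × ℝ => f q.1 q.2) (hC : ∀ y s, |f y s| ≤ C)
    (hg : Measurable fun q : E n × ℝ => g q.1 q.2) (hD : ∀ y s, |g y s| ≤ D)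
    (x : E n) {t : ℝ} (ht : 0 ≤ t) :
    AA n (fun y s => f y s - g y s) x t = AA n f x t - AA n g x t := by
  unfold AA
  rw [← intervalIntegral.integral_sub (PP_ii hn hf hC x ht le_rfl) (PP_ii hn hg hD x ht le_rfl)]
  refine intervalIntegral.integral_congr_ae (Filter.Eventually.of_forall fun s hs => ?_)
  rw [uIoc_of_le ht] at hs
  rcases hs.2.eq_or_lt with rfl | hlt
  · simp [PP_zero hn]
  · have hpos : 0 < t - s := sub_pos.2 hlt
    simp only [PP]
    rw [← integral_sub (PP_int hpos (meas_slice hf s) (fun y => hC y s) x)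
      (PP_int hpos (meas_slice hg s) (fun y => hD y s) x)]
    simp only [mul_sub]

lemma super {n : ℕ} (hn : 1 ≤ n) {T L K C0 CB : ℝ} {F B : E n → ℝ → ℝ} {G0 : E n → ℝ}
    (hFm : Measurable fun q : E n × ℝ => F q.1 q.2) (hF : ∀ y s, |F y s| ≤ L)
    (hGm : Measurable G0) (hG : ∀ y, |G0 y| ≤ C0) (hGn : ∀ y, 0 ≤ G0 y)
    {S : ℝ → ℝ} (hS : ∀ a b, IntervalIntegrable S volume a b) (hK : ∀ s, |S s| ≤ K)
    (hFS : ∀ y, ∀ s ∈ Ioc 0 T, F y s ≤ S s)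
    (hBm : Measurable fun q : E n × ℝ => B q.1 q.2) (hBb : ∀ y s, |B y s| ≤ CB)
    (hB : ∀ y, ∀ s ∈ Ioc 0 T, B y s = Real.exp (∫ r in (0:ℝ)..s, S r) * PP n s G0 y)
    (x : E n) {t : ℝ} (ht : t ∈ Ioc 0 T) :
    PP n t G0 x + AA n (fun y s => F y s * B y s) x t ≤ B x t := by
  have hfm : Measurable fun q : E n × ℝ => F q.1 q.2 * B q.1 q.2 := hFm.mul hBm
  have hf : ∀ y s, |F y s * B y s| ≤ L * CB := fun y s => by
    rw [abs_mul]
    exact mul_le_mul (hF y s) (hBb y s) (abs_nonneg _) ((abs_nonneg _).trans (hF y s))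
  have hcont : Continuous fun s => Real.exp (∫ r in (0:ℝ)..s, S r) :=
    Real.continuous_exp.comp (intervalIntegral.continuous_primitive hS 0)
  have h1 : AA n (fun y s => F y s * B y s) x t
      ≤ ∫ s in (0:ℝ)..t, (S s * Real.exp (∫ r in (0:ℝ)..s, S r)) * PP n t G0 x := by
    unfold AA
    refine intervalIntegral.integral_mono_on_of_le_Ioo ht.1.le
      (PP_ii hn (f := fun y s => F y s * B y s) hfm hf x ht.1.le le_rfl)
      (((hS 0 t).mul_continuousOn hcont.continuousOn).mul_const _) fun s hs => ?_
    have hsT : s ∈ Ioc 0 T := ⟨hs.1, hs.2.le.trans ht.2⟩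
    have hpos : 0 < t - s := sub_pos.2 hs.2
    have e5 := PP_semi hpos hs.1 hGm hG x
    rw [sub_add_cancel] at e5
    rw [← e5]
    have m1 : Measurable (fun y => PP n s G0 y) :=
      (PP_meas' hGm).comp (f := fun y : E n => (y, s)) (by fun_prop)
    have b1 : ∀ y, |PP n s G0 y| ≤ C0 := fun y => PP_abs hn hs.1.le hGm hG y
    conv_rhs => unfold PP
    rw [← integral_const_mul]
    refine integral_mono (PP_int hpos (meas_slice (f := fun y s => F y s * B y s) hfm s)
      (fun y => hf y s) x) ((PP_int hpos m1 b1 x).const_mul _) fun y => ?_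
    have hk := heatK_nonneg n (x - y) hpos.le
    have hp : 0 ≤ PP n s G0 y := PP_nonneg hs.1.le hGn y
    have hex := Real.exp_pos (∫ r in (0:ℝ)..s, S r)
    have h2 : F y s * B y s ≤ S s * B y s := by
      refine mul_le_mul_of_nonneg_right (hFS y s hsT) ?_
      rw [hB y s hsT]
      positivity
    calc heatK n (x - y) (t - s) * (F y s * B y s)
        ≤ heatK n (x - y) (t - s) * (S s * B y s) := mul_le_mul_of_nonneg_left h2 hk
      _ = _ := by rw [hB y s hsT]; simp only [PP]; ring
  rw [intervalIntegral.integral_mul_const, exp_ftc hS hK] at h1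
  rw [hB x t ht]
  linarith

/-- upper estimation. The sum G of the convolution series for a bounded
continuous potential F is dominated by exp(int_0^t sup_x F(x,s) ds) times the free heat
evolution of the nonnegative bounded initial data G0. -/
theorem stmt11 (n : ℕ) (hn : 1 ≤ n) (T M : ℝ) (hT : 0 < T) (hM : 0 < M)
    (F : E n → ℝ → ℝ) (hFc : Continuous fun q : E n × ℝ => F q.1 q.2)
    (hFb : ∀ (x : E n) (t : ℝ), |F x t| ≤ M)
    (m S : ℝ → ℝ)
    (hm : ∀ s ∈ Set.Icc (0:ℝ) T, m s = ⨅ x : E n, F x s)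
    (hS : ∀ s ∈ Set.Icc (0:ℝ) T, S s = ⨆ x : E n, F x s)
    (hmint : IntervalIntegrable m MeasureTheory.volume 0 T)
    (hSint : IntervalIntegrable S MeasureTheory.volume 0 T)
    (G₀ : E n → ℝ) (hG₀c : Continuous G₀) (hG₀0 : ∀ x, 0 ≤ G₀ x)
    (hG₀b : ∃ C, ∀ x, G₀ x ≤ C)
    (Gk : ℕ → E n → ℝ → ℝ)
    (hGk0 : ∀ x t, Gk 0 x t = conv n (fun y => heatK n y t) G₀ x)
    (hGkS : ∀ k x t, Gk (k + 1) x t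
      = ∫ s in (0:ℝ)..t, conv n (fun y => heatK n y (t - s)) (fun y => F y s * Gk k y s) x)
    (G : E n → ℝ → ℝ)
    (hG : ∀ (x : E n), ∀ t ∈ Set.Ioc 0 T, HasSum (fun k => Gk k x t) (G x t)) :
    ∀ (x : E n), ∀ t ∈ Set.Ioc 0 T,
      G x t ≤ Real.exp (∫ s in (0:ℝ)..t, S s) * conv n (fun y => heatK n y t) G₀ x := by
  intro x₀ t₀ ht₀
  obtain ⟨C₁, hC₁⟩ := hG₀b
  have hGm : Measurable G₀ := hG₀c.measurable
  have hG₀a : ∀ y, |G₀ y| ≤ C₁ := fun y => by rw [abs_of_nonneg (hG₀0 y)]; exact hC₁ y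
  have hC0 : 0 ≤ C₁ := (abs_nonneg _).trans (hG₀a 0)
  have hFm : Measurable fun q : E n × ℝ => F q.1 q.2 := hFc.measurable
  have hFabove : ∀ s, BddAbove (range fun y : E n => F y s) := fun s =>
    ⟨M, by rintro _ ⟨y, rfl⟩; exact (abs_le.1 (hFb y s)).2⟩
  -- the series terms
  have hk0 : ∀ x t, Gk 0 x t = PP n t G₀ x := fun x t => hGk0 x t
  have hkS : ∀ k x t, Gk (k + 1) x t = AA n (fun y s => F y s * Gk k y s) x t :=
    fun k x t => hGkS k x t
  have hkm : ∀ k, Measurable fun q : E n × ℝ => Gk k q.1 q.2 := by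
    intro k
    induction k with
    | zero => simp_rw [hk0]; exact PP_meas' hGm
    | succ k ih =>
      simp_rw [hkS]
      exact AA_meas (f := fun y s => F y s * Gk k y s) (hFm.mul ih)
  set v : ℕ → E n → ℝ → ℝ := fun k y s => if s ∈ Ioc 0 T then Gk k y s else 0 with hv
  have hcut : ∀ g : E n → ℝ → ℝ, (Measurable fun q : E n × ℝ => g q.1 q.2) →
      Measurable fun q : E n × ℝ => if q.2 ∈ Ioc 0 T then g q.1 q.2 else 0 := fun g hg =>
    Measurable.ite (measurable_snd measurableSet_Ioc) hg measurable_const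
  have hvm : ∀ k, Measurable fun q : E n × ℝ => v k q.1 q.2 := fun k => hcut _ (hkm k)
  have hvS : ∀ k x, ∀ t ∈ Ioc 0 T, v (k + 1) x t = AA n (fun y s => F y s * v k y s) x t := by
    intro k x t ht
    simp only [hv, if_pos ht, hkS]
    unfold AA
    refine intervalIntegral.integral_congr_ae (Filter.Eventually.of_forall fun s hs => ?_)
    rw [uIoc_of_le ht.1.le] at hs
    have hsT : s ∈ Ioc 0 T := ⟨hs.1, hs.2.trans ht.2⟩
    simp only [if_pos hsT]
  have hvb' : ∀ k x, ∀ t ∈ Ioc 0 T, |v k x t| ≤ C₁ * ((M * t) ^ k / k.factorial) := by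
    intro k
    induction k with
    | zero =>
      intro x t ht
      simp only [hv, if_pos ht, hk0]
      simpa using PP_abs hn ht.1.le hGm hG₀a x
    | succ k ih =>
      intro x t ht
      rw [hvS k x t ht]
      have hinteg : ∫ s in (0:ℝ)..t, M * (C₁ * ((M * s) ^ k / k.factorial))
          = C₁ * ((M * t) ^ (k + 1) / (k + 1).factorial) := by
        have : ∀ s : ℝ, M * (C₁ * ((M * s) ^ k / k.factorial))
            = (M * C₁ * M ^ k / k.factorial) * s ^ k := fun s => by rw [mul_pow]; ring
        simp_rw [this]
        rw [intervalIntegral.integral_const_mul, integral_pow, Nat.factorial_succ]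
        push_cast
        have : (k.factorial : ℝ) ≠ 0 := by positivity
        field_simp
        ring
      rw [← hinteg]
      unfold AA
      rw [← Real.norm_eq_abs]
      refine intervalIntegral.norm_integral_le_of_norm_le ht.1.le
        (Filter.Eventually.of_forall fun s hs => ?_)
        (Continuous.intervalIntegrable (μ := volume)
          (u := fun s => M * (C₁ * ((M * s) ^ k / k.factorial))) (by fun_prop) _ _)
      have hsT : s ∈ Ioc 0 T := ⟨hs.1, hs.2.trans ht.2⟩
      refine PP_abs hn (by linarith [hs.2])
        (meas_slice (f := fun y s => F y s * v k y s) (hFm.mul (hvm k)) s) (fun y => ?_) x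
      rw [abs_mul]
      exact mul_le_mul (hFb y s) (ih y s hsT) (abs_nonneg _) hM.le
  set b : ℕ → ℝ := fun k => C₁ * ((M * T) ^ k / k.factorial) with hb
  have hbs : Summable b := (Real.summable_pow_div_factorial (M * T)).mul_left C₁
  have hb0 : ∀ k, 0 ≤ b k := fun k => by simp only [hb]; positivity
  have hvb : ∀ k x t, |v k x t| ≤ b k := by
    intro k x t
    by_cases ht : t ∈ Ioc 0 T
    · refine (hvb' k x t ht).trans ?_
      have := ht.1
      have := ht.2
      simp only [hb]
      gcongr
    · simp only [hv, if_neg ht, abs_zero]; exact hb0 k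
  -- the sum
  set u : E n → ℝ → ℝ := fun y s => if s ∈ Ioc 0 T then G y s else 0 with hu
  have husum : ∀ x t, HasSum (fun k => v k x t) (u x t) := by
    intro x t
    by_cases ht : t ∈ Ioc 0 T
    · simp only [hv, hu, if_pos ht]; exact hG x t ht
    · simp only [hv, hu, if_neg ht]; exact hasSum_zero
  have hub : ∀ x t, |u x t| ≤ ∑' k, b k := fun x t =>
    (husum x t).norm_le_of_bounded hbs.hasSum fun k => hvb k x t
  have hum : Measurable fun q : E n × ℝ => u q.1 q.2 := by
    refine measurable_of_tendsto_metrizable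
      (f := fun N (q : E n × ℝ) => ∑ k ∈ Finset.range N, v k q.1 q.2)
      (fun N => Finset.measurable_fun_sum _ fun k _ => hvm k) ?_
    rw [tendsto_pi_nhds]
    exact fun q => (husum q.1 q.2).tendsto_sum_nat
  have hueq : ∀ x, ∀ t ∈ Ioc 0 T,
      u x t = PP n t G₀ x + AA n (fun y s => F y s * u y s) x t := by
    intro x t ht
    have hFvb : ∀ k y s, |F y s * v k y s| ≤ M * b k := fun k y s => by
      rw [abs_mul]
      exact mul_le_mul (hFb y s) (hvb k y s) (abs_nonneg _) hM.le
    have hbs' : Summable fun k => M * b k := hbs.mul_left M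
    have h1 : HasSum (fun k => AA n (fun y s => F y s * v k y s) x t)
        (AA n (fun y s => F y s * u y s) x t) := by
      unfold AA
      refine intervalIntegral.hasSum_integral_of_dominated_convergence (fun k _ => M * b k)
        (fun k => ?_) (fun k => Filter.Eventually.of_forall fun s hs => ?_)
        (Filter.Eventually.of_forall fun s hs => hbs')
        (Continuous.intervalIntegrable (by fun_prop) _ _)
        (Filter.Eventually.of_forall fun s hs => ?_)
      · have hm' : Measurable (fun s => PP n (t - s) (fun y => F y s * v k y s) x) :=
          (PP_meas (f := fun y s => F y s * v k y s) (hFm.mul (hvm k))).comp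
            (f := fun s : ℝ => ((x, t), s)) (by fun_prop)
        exact hm'.aestronglyMeasurable
      · rw [uIoc_of_le ht.1.le] at hs
        exact PP_abs hn (by linarith [hs.2])
          (meas_slice (f := fun y s => F y s * v k y s) (hFm.mul (hvm k)) s)
          (fun y => hFvb k y s) x
      · rw [uIoc_of_le ht.1.le] at hs
        rcases hs.2.eq_or_lt with rfl | hlt
        · simp only [sub_self, PP_zero hn]; exact hasSum_zero
        · have hpos : 0 < t - s := sub_pos.2 hlt
          unfold PP
          refine hasSum_integral_of_dominated_convergence
            (fun k y => heatK n (x - y) (t - s) * (M * b k)) (fun k => ?_)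
            (fun k => Filter.Eventually.of_forall fun y => ?_)
            (Filter.Eventually.of_forall fun y => hbs'.mul_left _) ?_
            (Filter.Eventually.of_forall fun y => ?_)
          · exact (PP_int hpos
              (meas_slice (f := fun y s => F y s * v k y s) (hFm.mul (hvm k)) s)
              (fun y => hFvb k y s) x).aestronglyMeasurable
          · rw [norm_mul, Real.norm_of_nonneg (heatK_nonneg n _ hpos.le)]
            exact mul_le_mul_of_nonneg_left (hFvb k y s) (heatK_nonneg n _ hpos.le)
          · simp_rw [tsum_mul_left]
            exact ((heatK_integrable n hpos).comp_sub_left x).mul_const _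
          · exact ((husum y s).mul_left (F y s)).mul_left _
    have h2 : HasSum (fun k => v (k + 1) x t) (AA n (fun y s => F y s * u y s) x t) := by
      simp_rw [hvS _ x t ht]; exact h1
    have h3 := (hasSum_nat_add_iff' 1).2 (husum x t)
    have h4 := h3.unique h2
    have h5 : v 0 x t = PP n t G₀ x := by simp only [hv, if_pos ht, hk0]
    simp only [Finset.range_one, Finset.sum_singleton, h5] at h4
    linarith
  -- the barrier
  set S₁ : ℝ → ℝ := fun s => (Icc 0 T).indicator S s + M with hS₁
  have hSle : ∀ s ∈ Icc 0 T, |S s| ≤ M := by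
    intro s hs
    rw [hS s hs, abs_le]
    constructor
    · exact (abs_le.1 (hFb 0 s)).1.trans (le_ciSup (hFabove s) 0)
    · exact ciSup_le fun y => (abs_le.1 (hFb y s)).2
  have hS₁i : ∀ a b, IntervalIntegrable S₁ volume a b := by
    intro a b
    have h1 : IntegrableOn S (Icc 0 T) := by
      rw [integrableOn_Icc_iff_integrableOn_Ioc]
      exact (intervalIntegrable_iff_integrableOn_Ioc_of_le hT.le).1 hSint
    have h2 : Integrable ((Icc 0 T).indicator S) := h1.integrable_indicator measurableSet_Icc
    exact h2.intervalIntegrable.add intervalIntegrable_const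
  have hS₁b : ∀ s, |S₁ s| ≤ 2 * M := by
    intro s
    have h1 : |(Icc 0 T).indicator S s| ≤ M := by
      by_cases hs : s ∈ Icc 0 T
      · rw [indicator_of_mem hs]; exact hSle s hs
      · rw [indicator_of_notMem hs, abs_zero]; exact hM.le
    calc |S₁ s| ≤ |(Icc 0 T).indicator S s| + |M| := abs_add_le _ _
      _ ≤ 2 * M := by rw [abs_of_pos hM]; linarith
  have hF₁m : Measurable fun q : E n × ℝ => F q.1 q.2 + M := hFm.add measurable_const
  have hF₁0 : ∀ y s, 0 ≤ F y s + M := fun y s => by linarith [(abs_le.1 (hFb y s)).1]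
  have hF₁L : ∀ y s, F y s + M ≤ 2 * M := fun y s => by linarith [(abs_le.1 (hFb y s)).2]
  have hF₁a : ∀ y s, |F y s + M| ≤ 2 * M := fun y s => by
    rw [abs_of_nonneg (hF₁0 y s)]; exact hF₁L y s
  have hFS : ∀ y, ∀ s ∈ Ioc 0 T, F y s + M ≤ S₁ s := by
    intro y s hs
    have hs' : s ∈ Icc 0 T := ⟨hs.1.le, hs.2⟩
    simp only [hS₁, indicator_of_mem hs', hS s hs']
    linarith [le_ciSup (hFabove s) y]
  set B : E n → ℝ → ℝ := fun y s =>
    if s ∈ Ioc 0 T then Real.exp (∫ r in (0:ℝ)..s, S₁ r) * PP n s G₀ y else 0 with hB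
  have hcont : Continuous fun s => Real.exp (∫ r in (0:ℝ)..s, S₁ r) :=
    Real.continuous_exp.comp (intervalIntegral.continuous_primitive hS₁i 0)
  have hBm : Measurable fun q : E n × ℝ => B q.1 q.2 :=
    hcut (fun y s => Real.exp (∫ r in (0:ℝ)..s, S₁ r) * PP n s G₀ y)
      ((hcont.measurable.comp measurable_snd).mul (PP_meas' hGm))
  obtain ⟨R, hR⟩ := (isCompact_Icc (a := (0:ℝ)) (b := T)).exists_bound_of_continuousOn
    hcont.continuousOn
  have hR0 : 0 ≤ R := (norm_nonneg _).trans (hR 0 ⟨le_rfl, hT.le⟩)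
  have hBb : ∀ y s, |B y s| ≤ R * C₁ := by
    intro y s
    by_cases hs : s ∈ Ioc 0 T
    · simp only [hB, if_pos hs, abs_mul]
      exact mul_le_mul (hR s ⟨hs.1.le, hs.2⟩) (PP_abs hn hs.1.le hGm hG₀a y) (abs_nonneg _) hR0
    · simp only [hB, if_neg hs, abs_zero]; positivity
  have hsup := fun x t (ht : t ∈ Ioc 0 T) =>
    super hn (F := fun y s => F y s + M) hF₁m hF₁a hGm hG₀a hG₀0 hS₁i hS₁b hFS hBm hBb
      (fun y s hs => by simp only [hB, if_pos hs]) x ht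
  have hshift := fun x t (ht : t ∈ Ioc 0 T) =>
    shift_eq hn hFm hFb hum hub hGm hG₀a hueq x ht
  have hHm : Measurable fun q : E n × ℝ => Real.exp (M * q.2) * u q.1 q.2 :=
    Measurable.mul (by fun_prop) hum
  have hHb : ∀ y s, |Real.exp (M * s) * u y s| ≤ Real.exp (M * T) * ∑' k, b k := by
    intro y s
    by_cases hs : s ∈ Ioc 0 T
    · rw [abs_mul, abs_of_pos (Real.exp_pos _)]
      refine mul_le_mul (Real.exp_le_exp.2 ?_) (hub y s) (abs_nonneg _) (Real.exp_pos _).le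
      exact mul_le_mul_of_nonneg_left hs.2 hM.le
    · simp only [hu, if_neg hs, mul_zero, abs_zero]
      exact mul_nonneg (Real.exp_pos _).le (tsum_nonneg hb0)
  have hprod : ∀ (g : E n → ℝ → ℝ) (c : ℝ), (∀ y s, |g y s| ≤ c) →
      ∀ y s, |(F y s + M) * g y s| ≤ 2 * M * c := fun g c hg y s => by
    rw [abs_mul]
    exact mul_le_mul (hF₁a y s) (hg y s) (abs_nonneg _) (by positivity)
  have hfin := gron hn (T := T) (L := 2 * M) (C := Real.exp (M * T) * (∑' k, b k) + R * C₁)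
    (F := fun y s => F y s + M) (D := fun y s => Real.exp (M * s) * u y s - B y s)
    hF₁m hF₁0 hF₁L (hHm.sub hBm)
    (fun y s => (abs_sub _ _).trans (add_le_add (hHb y s) (hBb y s)))
    (fun x t ht => by
      have e := AA_sub hn (f := fun y s => (F y s + M) * (Real.exp (M * s) * u y s))
        (g := fun y s => (F y s + M) * B y s) (hF₁m.mul hHm)
        (hprod (fun y s => Real.exp (M * s) * u y s) _ hHb) (hF₁m.mul hBm)
        (hprod B _ hBb) x ht.1.le
      have h1 := hsup x t ht
      have h2 := hshift x t ht
      simp only [mul_sub]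
      rw [e]
      linarith) x₀ ht₀
  have hinteg : ∫ r in (0:ℝ)..t₀, S₁ r = (∫ s in (0:ℝ)..t₀, S s) + M * t₀ := by
    have h1 : ∫ r in (0:ℝ)..t₀, S₁ r = ∫ r in (0:ℝ)..t₀, (S r + M) := by
      refine intervalIntegral.integral_congr fun s hs => ?_
      rw [uIcc_of_le ht₀.1.le] at hs
      have hs' : s ∈ Icc 0 T := ⟨hs.1, hs.2.trans ht₀.2⟩
      simp only [hS₁, indicator_of_mem hs']
    rw [h1, intervalIntegral.integral_add _ intervalIntegrable_const,
      intervalIntegral.integral_const]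
    · simp [mul_comm]
    · refine hSint.mono_set ?_
      rw [uIcc_of_le ht₀.1.le, uIcc_of_le hT.le]
      exact Icc_subset_Icc le_rfl ht₀.2
  simp only [hu, hB, if_pos ht₀, hinteg, Real.exp_add] at hfin
  have hexp := Real.exp_pos (M * t₀)
  change G x₀ t₀ ≤ Real.exp (∫ s in (0:ℝ)..t₀, S s) * PP n t₀ G₀ x₀
  refine le_of_mul_le_mul_left ?_ hexp
  linarith
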